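/- Let s ≥ 1, ε ∈ (0,1] and 0 < τ ≤ 1/ε^p. Let ψ(t) = S_{e,t}(ψ₀) be the exact solution of the relativistic NLSE and assume ψ ∈ L^∞([0,T_ε]; H^{s+1}(Ω)). Consider the alternative Strang splitting S̃_τ = φ_V^{τ/2} ∘ φ_T^{τ} ∘ φ_V^{τ/2}. Then there exists a constant C > 0, depending on ‖ψ‖_{L^∞([0,T_ε];H^{s+1})}, such that for every t_n = nτ with t_n + τ ≤ T_ε the local error satisfies ‖S̃_τ(ψ(t_n)) − S_{e,τ}(ψ(t_n))‖_s ≤ C ε^p τ³. -/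

import Mathlib

/- Periodic functions on Ω = (a,b) are represented by their Fourier coefficient
sequences `c : ℤ → ℂ`, i.e. `z(x) = ∑_{l∈ℤ} c l * exp(i μ_l (x−a))` with
`μ_l = 2πl/(b−a)`.  All operators are expressed on the Fourier side:
`⟨∇⟩`, `⟨∇⟩⁻¹`, `e^{it⟨∇⟩}` act diagonally, complex conjugation of the function
corresponds to `l ↦ conj (c (−l))`, and the pointwise product of two functions
corresponds to the convolution of their coefficient sequences. -/

noncomputable section

namespace NKGE

/-- Fourier frequency `μ_l = 2πl/(b−a)`. -/
def mu (a b : ℝ) (l : ℤ) : ℝ := 2 * Real.pi * l / (b - a)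

/-- `ζ_l = √(1+μ_l²)`, the Fourier symbol of `⟨∇⟩ = √(1−∂_xx)`. -/
def zeta (a b : ℝ) (l : ℤ) : ℝ := Real.sqrt (1 + mu a b l ^ 2)

/-- Squared `H^s`-norm: `‖z‖_s² = ∑_l (1+μ_l²)^s |ẑ_l|²`. -/
def sobNormSq (a b s : ℝ) (c : ℤ → ℂ) : ℝ := ∑' l : ℤ, (1 + mu a b l ^ 2) ^ s * ‖c l‖ ^ 2

/-- The `H^s`-norm `‖z‖_s`. -/
def sobNorm (a b s : ℝ) (c : ℤ → ℂ) : ℝ := Real.sqrt (sobNormSq a b s c)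

/-- Membership in `H^s(Ω)`. -/
def MemHs (a b s : ℝ) (c : ℤ → ℂ) : Prop :=
  Summable fun l : ℤ => (1 + mu a b l ^ 2) ^ s * ‖c l‖ ^ 2

/-- The operator `⟨∇⟩` acting in Fourier space. -/
def opJ (a b : ℝ) (c : ℤ → ℂ) : ℤ → ℂ := fun l => (zeta a b l : ℂ) * c l

/-- The operator `⟨∇⟩⁻¹` acting in Fourier space. -/
def opJinv (a b : ℝ) (c : ℤ → ℂ) : ℤ → ℂ := fun l => c l / (zeta a b l : ℂ)

/-- The operator `e^{it⟨∇⟩}` acting in Fourier space. -/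
def expJ (a b t : ℝ) (c : ℤ → ℂ) : ℤ → ℂ :=
  fun l => Complex.exp (Complex.I * (t : ℂ) * (zeta a b l : ℂ)) * c l

/-- Fourier coefficients of the complex conjugate function `z̄`. -/
def conjC (c : ℤ → ℂ) : ℤ → ℂ := fun l => (starRingEnd ℂ) (c (-l))

/-- Convolution of coefficient sequences = coefficients of the pointwise product. -/
def convC (c d : ℤ → ℂ) : ℤ → ℂ := fun l => ∑' m : ℤ, c m * d (l - m)

/-- Coefficients of the constant function `1`. -/
def oneC : ℤ → ℂ := fun l => if l = 0 then 1 else 0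

/-- Coefficients of the `n`-th pointwise power `z^n`. -/
def powC (c : ℤ → ℂ) : ℕ → ℤ → ℂ
  | 0 => oneC
  | n + 1 => convC c (powC c n)

/-- Coefficients of `(ψ + ψ̄)/2`. -/
def reC (c : ℤ → ℂ) : ℤ → ℂ := fun l => (c l + conjC c l) / 2

/-- Coefficients of `φ + φ̄`. -/
def addConj (c : ℤ → ℂ) : ℤ → ℂ := fun l => c l + conjC c l

/-- `G(φ) = f((φ+φ̄)/2)` with `f(v) = v^{p+1}`. -/
def Gop (p : ℕ) (c : ℤ → ℂ) : ℤ → ℂ := powC (reC c) (p + 1)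

/-- `F(φ) = i ⟨∇⟩⁻¹ G(φ)`. -/
def Fop (a b : ℝ) (p : ℕ) (c : ℤ → ℂ) : ℤ → ℂ := fun l => Complex.I * opJinv a b (Gop p c) l

/-- `F_t(φ) = e^{−it⟨∇⟩} F(e^{it⟨∇⟩} φ)`. -/
def Ft (a b : ℝ) (p : ℕ) (t : ℝ) (c : ℤ → ℂ) : ℤ → ℂ :=
  expJ a b (-t) (Fop a b p (expJ a b t c))

/-- `F'(φ)(η) = ((p+1)i/2^{p+1}) ⟨∇⟩⁻¹((φ+φ̄)^p (η+η̄))`. -/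
def Fd (a b : ℝ) (p : ℕ) (φ η : ℤ → ℂ) : ℤ → ℂ :=
  fun l => ((p : ℂ) + 1) * Complex.I / 2 ^ (p + 1) *
    opJinv a b (convC (powC (addConj φ) p) (addConj η)) l

/-- `F_t'(φ)(η) = e^{−it⟨∇⟩} F'(e^{it⟨∇⟩}φ)(e^{it⟨∇⟩}η)`. -/
def Ftd (a b : ℝ) (p : ℕ) (t : ℝ) (φ η : ℤ → ℂ) : ℤ → ℂ :=
  expJ a b (-t) (Fd a b p (expJ a b t φ) (expJ a b t η))

/-- `F''(φ)(η,ζ) = (p(p+1)i/2^{p+1}) ⟨∇⟩⁻¹((φ+φ̄)^{p−1}(η+η̄)(ζ+ζ̄))`. -/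
def Fdd (a b : ℝ) (p : ℕ) (φ η ζ : ℤ → ℂ) : ℤ → ℂ :=
  fun l => (p : ℂ) * ((p : ℂ) + 1) * Complex.I / 2 ^ (p + 1) *
    opJinv a b (convC (convC (powC (addConj φ) (p - 1)) (addConj η)) (addConj ζ)) l

/-- `F_t''(φ)(η,ζ) = e^{−it⟨∇⟩} F''(e^{it⟨∇⟩}φ)(e^{it⟨∇⟩}η, e^{it⟨∇⟩}ζ)`. -/
def Ftdd (a b : ℝ) (p : ℕ) (t : ℝ) (φ η ζ : ℤ → ℂ) : ℤ → ℂ :=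
  expJ a b (-t) (Fdd a b p (expJ a b t φ) (expJ a b t η) (expJ a b t ζ))

/-- The flow `φ_V^t(ψ₀) = ψ₀ + ε^p t F(ψ₀)` of the nonlinear subproblem. -/
def flowV (a b : ℝ) (p : ℕ) (ε t : ℝ) (c : ℤ → ℂ) : ℤ → ℂ :=
  fun l => c l + (ε ^ p * t) • Fop a b p c l

/-- The Strang splitting operator `S_τ = φ_T^{τ/2} ∘ φ_V^{τ} ∘ φ_T^{τ/2}`. -/
def strang (a b : ℝ) (p : ℕ) (ε τ : ℝ) (c : ℤ → ℂ) : ℤ → ℂ :=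
  expJ a b (τ / 2) (flowV a b p ε τ (expJ a b (τ / 2) c))

/-- The alternative Strang splitting `S̃_τ = φ_V^{τ/2} ∘ φ_T^{τ} ∘ φ_V^{τ/2}`. -/
def strang2 (a b : ℝ) (p : ℕ) (ε τ : ℝ) (c : ℤ → ℂ) : ℤ → ℂ :=
  flowV a b p ε (τ / 2) (expJ a b τ (flowV a b p ε (τ / 2) c))

/-- `Ψ` is an exact solution of the relativistic NLSE
`i∂_tψ + ⟨∇⟩ψ + ε^p ⟨∇⟩⁻¹ G(ψ) = 0`, written on the Fourier side, i.e.
`ψ' = i(ζ_l ψ_l + ε^p ζ_l⁻¹ (G(ψ))_l)`. -/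
def IsExactSol (a b : ℝ) (p : ℕ) (ε : ℝ) (Ψ : ℝ → ℤ → ℂ) : Prop :=
  ∀ (t : ℝ) (l : ℤ), HasDerivAt (fun s => Ψ s l)
    (Complex.I * ((zeta a b l : ℂ) * Ψ t l + (ε ^ p : ℂ) * Gop p (Ψ t) l / (zeta a b l : ℂ))) t

/-- Pointwise-in-`t` derivative `∂_t F_t(φ)`. -/
def dFt (a b : ℝ) (p : ℕ) (t : ℝ) (c : ℤ → ℂ) : ℤ → ℂ :=
  fun l => deriv (fun τ => Ft a b p τ c l) t

/-- Second derivative `∂_t² F_t(φ)`. -/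
def d2Ft (a b : ℝ) (p : ℕ) (t : ℝ) (c : ℤ → ℂ) : ℤ → ℂ :=
  fun l => deriv (fun τ => dFt a b p τ c l) t

/-- Derivative `∂_t F_t'(φ)(η)`. -/
def dFtd (a b : ℝ) (p : ℕ) (t : ℝ) (φ η : ℤ → ℂ) : ℤ → ℂ :=
  fun l => deriv (fun τ => Ftd a b p τ φ η l) t


/-- Quantitative `H^σ` bound: `‖c‖_σ ≤ M`. -/
def HB (a b σ : ℝ) (c : ℤ → ℂ) (M : ℝ) : Prop :=
  0 ≤ M ∧ ∀ S : Finset ℤ, ∑ l ∈ S, (zeta a b l ^ σ * ‖c l‖) ^ 2 ≤ M ^ 2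

lemma one_le_zeta (a b : ℝ) (l : ℤ) : 1 ≤ zeta a b l := by
  unfold zeta
  rw [Real.one_le_sqrt]
  nlinarith [sq_nonneg (mu a b l)]

lemma zeta_pos (a b : ℝ) (l : ℤ) : 0 < zeta a b l := lt_of_lt_of_le one_pos (one_le_zeta a b l)

lemma zeta_neg (a b : ℝ) (l : ℤ) : zeta a b (-l) = zeta a b l := by
  unfold zeta mu
  congr 2
  push_cast
  ring

lemma zeta_zero (a b : ℝ) : zeta a b 0 = 1 := by
  simp [zeta, mu]

lemma zeta_sq (a b : ℝ) (l : ℤ) : zeta a b l ^ 2 = 1 + mu a b l ^ 2 := by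
  unfold zeta
  rw [Real.sq_sqrt]
  positivity

lemma zeta_rpow_sq (a b s : ℝ) (l : ℤ) : (zeta a b l ^ s) ^ 2 = (1 + mu a b l ^ 2) ^ s := by
  rw [← zeta_sq, ← Real.rpow_natCast, ← Real.rpow_natCast, ← Real.rpow_mul (zeta_pos a b l).le,
    ← Real.rpow_mul (zeta_pos a b l).le, mul_comm]

lemma zr_pos (a b σ : ℝ) (l : ℤ) : 0 < zeta a b l ^ σ := Real.rpow_pos_of_pos (zeta_pos a b l) _

lemma zeta_tri (a b : ℝ) (l m : ℤ) : zeta a b l ≤ zeta a b m + zeta a b (l - m) := by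
  have h1 := one_le_zeta a b m
  have h2 := one_le_zeta a b (l - m)
  have hm : mu a b l = mu a b m + mu a b (l - m) := by
    unfold mu; push_cast; ring
  have e1 := zeta_sq a b m
  have e2 := zeta_sq a b (l - m)
  have e := zeta_sq a b l
  refine abs_le_of_sq_le_sq' ?_ (by linarith) |>.2
  rw [e, hm]
  have : mu a b m * mu a b (l - m) ≤ zeta a b m * zeta a b (l - m) := by
    refine abs_le_of_sq_le_sq' ?_ (by positivity) |>.2
    rw [mul_pow, mul_pow, e1, e2]
    nlinarith [sq_nonneg (mu a b m), sq_nonneg (mu a b (l - m))]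
  nlinarith

lemma summable_zeta (a b : ℝ) (hab : a < b) : Summable fun l : ℤ => (1 / zeta a b l) ^ 2 := by
  have hs : Summable fun l : ℤ => ((b - a) / (2 * Real.pi)) ^ 2 * (1 / (l : ℝ) ^ 2) :=
    (Real.summable_one_div_int_pow.2 (by norm_num)).mul_left _
  refine Summable.of_norm_bounded_eventually hs ?_
  have : {l : ℤ | ¬ ‖(1 / zeta a b l) ^ 2‖ ≤
      ((b - a) / (2 * Real.pi)) ^ 2 * (1 / (l : ℝ) ^ 2)} ⊆ {0} := by
    intro l hl
    by_contra h0
    apply hl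
    have hl0 : (l : ℝ) ≠ 0 := by
      simpa using h0
    have hba : 0 < b - a := by linarith
    have hmu : mu a b l ≠ 0 := by
      unfold mu
      have := Real.pi_pos
      positivity
    rw [Real.norm_of_nonneg (by positivity), div_pow, zeta_sq, one_pow]
    have e : ((b - a) / (2 * Real.pi)) ^ 2 * (1 / (l : ℝ) ^ 2) = 1 / mu a b l ^ 2 := by
      unfold mu
      have := Real.pi_pos.ne'
      field_simp
    rw [e]
    apply one_div_le_one_div_of_le
    · positivity
    · linarith
  exact (Set.finite_singleton (0 : ℤ)).subset this

namespace HB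

variable {a b σ : ℝ} {c d : ℤ → ℂ} {M M' : ℝ}

lemma nonneg (h : HB a b σ c M) : 0 ≤ M := h.1

lemma of_le {σ' Q : ℝ} (h : HB a b σ' d M) (hQ : 0 ≤ Q)
    (hle : ∀ l, zeta a b l ^ σ * ‖c l‖ ≤ Q * (zeta a b l ^ σ' * ‖d l‖)) : HB a b σ c (Q * M) := by
  refine ⟨mul_nonneg hQ h.1, fun S => ?_⟩
  calc ∑ l ∈ S, (zeta a b l ^ σ * ‖c l‖) ^ 2
      ≤ ∑ l ∈ S, Q ^ 2 * (zeta a b l ^ σ' * ‖d l‖) ^ 2 := by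
        refine Finset.sum_le_sum fun l _ => ?_
        rw [← mul_pow]
        have := zr_pos a b σ l
        exact pow_le_pow_left₀ (by positivity) (hle l) 2
    _ = Q ^ 2 * ∑ l ∈ S, (zeta a b l ^ σ' * ‖d l‖) ^ 2 := by rw [Finset.mul_sum]
    _ ≤ (Q * M) ^ 2 := by
        rw [mul_pow]
        exact mul_le_mul_of_nonneg_left (h.2 S) (by positivity)

lemma mono (h : HB a b σ c M) (hM : M ≤ M') : HB a b σ c M' :=
  ⟨h.1.trans hM, fun S => (h.2 S).trans (pow_le_pow_left₀ h.1 hM 2)⟩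

lemma lower {σ' : ℝ} (h : HB a b σ' c M) (hs : σ ≤ σ') : HB a b σ c M := by
  have := h.of_le (c := c) (σ := σ) zero_le_one (fun l => ?_)
  · simpa using this
  · rw [one_mul]
    exact mul_le_mul_of_nonneg_right
      (Real.rpow_le_rpow_of_exponent_le (one_le_zeta a b l) hs) (norm_nonneg _)

lemma smul (k : ℂ) (h : HB a b σ c M) : HB a b σ (fun l => k * c l) (‖k‖ * M) := by
  refine h.of_le (norm_nonneg k) fun l => le_of_eq ?_
  rw [norm_mul]; ring

lemma add (h : HB a b σ c M) (h' : HB a b σ d M') : HB a b σ (fun l => c l + d l) (M + M') := by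
  refine ⟨add_nonneg h.1 h'.1, fun S => ?_⟩
  have key := Finset.sum_mul_sq_le_sq_mul_sq S (fun l => zeta a b l ^ σ * ‖c l‖)
    (fun l => zeta a b l ^ σ * ‖d l‖)
  have h1 := h.2 S
  have h2 := h'.2 S
  have hc : ∑ l ∈ S, (zeta a b l ^ σ * ‖c l‖) * (zeta a b l ^ σ * ‖d l‖) ≤ M * M' := by
    refine abs_le_of_sq_le_sq' ?_ (mul_nonneg h.1 h'.1) |>.2
    refine key.trans ?_
    rw [mul_pow]
    exact mul_le_mul h1 h2 (Finset.sum_nonneg fun _ _ => sq_nonneg _) (sq_nonneg _)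
  calc ∑ l ∈ S, (zeta a b l ^ σ * ‖c l + d l‖) ^ 2
      ≤ ∑ l ∈ S, ((zeta a b l ^ σ * ‖c l‖) ^ 2 + (zeta a b l ^ σ * ‖d l‖) ^ 2
          + 2 * ((zeta a b l ^ σ * ‖c l‖) * (zeta a b l ^ σ * ‖d l‖))) := by
        refine Finset.sum_le_sum fun l _ => ?_
        have := zr_pos a b σ l
        calc (zeta a b l ^ σ * ‖c l + d l‖) ^ 2 ≤ (zeta a b l ^ σ * (‖c l‖ + ‖d l‖)) ^ 2 := by
              gcongr
              exact norm_add_le _ _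
          _ = _ := by ring
    _ ≤ (M + M') ^ 2 := by
        rw [Finset.sum_add_distrib, Finset.sum_add_distrib, ← Finset.mul_sum]
        nlinarith

lemma neg (h : HB a b σ c M) : HB a b σ (fun l => - c l) M := by
  have := h.smul (-1)
  simpa using this

lemma sub (h : HB a b σ c M) (h' : HB a b σ d M') : HB a b σ (fun l => c l - d l) (M + M') := by
  simpa [sub_eq_add_neg] using h.add h'.neg

lemma conj (h : HB a b σ c M) : HB a b σ (conjC c) M := by
  refine ⟨h.1, fun S => ?_⟩
  refine le_trans (le_of_eq ?_) (h.2 (S.map (Equiv.neg ℤ).toEmbedding))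
  rw [Finset.sum_map]
  refine Finset.sum_congr rfl fun l _ => ?_
  simp [conjC, zeta_neg]

lemma reC (h : HB a b σ c M) : HB a b σ (reC c) M := by
  have := (h.add h.conj).smul (1 / 2)
  have e : ‖(1 / 2 : ℂ)‖ * (M + M) = M := by norm_num; ring
  rw [e] at this
  convert this using 2 with l
  unfold NKGE.reC
  ring

lemma summable (h : HB a b σ c M) : Summable fun l => (zeta a b l ^ σ * ‖c l‖) ^ 2 :=
  summable_of_sum_le (fun _ => sq_nonneg _) h.2

lemma tsum_le (h : HB a b σ c M) : ∑' l, (zeta a b l ^ σ * ‖c l‖) ^ 2 ≤ M ^ 2 :=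
  Real.tsum_le_of_sum_le (fun _ => sq_nonneg _) h.2

lemma sobNorm_le (h : HB a b σ c M) : sobNorm a b σ c ≤ M := by
  unfold sobNorm sobNormSq
  refine Real.sqrt_le_iff.2 ⟨h.1, ?_⟩
  refine le_trans (le_of_eq ?_) h.tsum_le
  refine tsum_congr fun l => ?_
  rw [mul_pow, zeta_rpow_sq]

lemma of_mem (h : MemHs a b σ c) (hM : sobNorm a b σ c ≤ M) : HB a b σ c M := by
  have h0 : 0 ≤ M := (Real.sqrt_nonneg _).trans hM
  refine ⟨h0, fun S => ?_⟩
  have h2 := (Real.sqrt_le_iff.1 hM).2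
  refine le_trans ?_ h2
  refine le_trans (le_of_eq ?_) (Summable.sum_le_tsum S (fun l _ => ?_) h)
  · refine Finset.sum_congr rfl fun l _ => ?_
    rw [mul_pow, zeta_rpow_sq]
  · positivity

lemma sq_summable (h : HB a b σ c M) (hs : 0 ≤ σ) : Summable fun l => ‖c l‖ ^ 2 := by
  simpa using (h.lower hs).summable

lemma conv_summable {α β : ℝ} (h : HB a b α c M) (h' : HB a b β d M') (hα : 0 ≤ α) (hβ : 0 ≤ β)
    (l : ℤ) : Summable fun m => ‖c m * d (l - m)‖ := by
  have h1 := h.sq_summable hα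
  have h2 := (Equiv.subLeft l).summable_iff.2 (h'.sq_summable hβ)
  refine Summable.of_nonneg_of_le (fun _ => norm_nonneg _) (fun m => ?_) (h1.add h2)
  simp only [Function.comp, Equiv.subLeft_apply, norm_mul]
  nlinarith [sq_nonneg (‖c m‖ - ‖d (l - m)‖), sq_nonneg (‖c m‖), sq_nonneg ‖d (l - m)‖]

lemma conv_aux {α β Q : ℝ} (h : HB a b α c M) (h' : HB a b β d M') (hα : 0 ≤ α) (hβ : 0 ≤ β)
    (hab : a < b) (hQ : 0 ≤ Q)
    (hk : ∀ l m, zeta a b l ^ σ ≤ Q * (1 / zeta a b m + 1 / zeta a b (l - m)) *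
      (zeta a b m ^ α * zeta a b (l - m) ^ β)) :
    HB a b σ (convC c d) (2 * Q * Real.sqrt (∑' l, (1 / zeta a b l) ^ 2) * M * M') := by
  have hW0 : 0 ≤ ∑' l, (1 / zeta a b l) ^ 2 := tsum_nonneg fun _ => sq_nonneg _
  set W := ∑' l, (1 / zeta a b l) ^ 2 with hW
  have hM := h.1
  have hM' := h'.1
  refine ⟨by positivity, fun S => ?_⟩
  set A : ℤ → ℝ := fun m => (zeta a b m ^ α * ‖c m‖) with hA
  set B : ℤ → ℝ := fun m => (zeta a b m ^ β * ‖d m‖) with hB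
  have hA0 : ∀ m, 0 ≤ A m := fun m => mul_nonneg (zr_pos a b α m).le (norm_nonneg _)
  have hB0 : ∀ m, 0 ≤ B m := fun m => mul_nonneg (zr_pos a b β m).le (norm_nonneg _)
  have hAs : Summable fun m => A m ^ 2 := h.summable
  have hBle : ∀ m, B m ^ 2 ≤ M' ^ 2 := fun m => by simpa using h'.2 {m}
  have hABs : ∀ l, Summable fun m => (A m * B (l - m)) ^ 2 := fun l => by
    refine Summable.of_nonneg_of_le (fun _ => sq_nonneg _) (fun m => ?_) (hAs.mul_right (M' ^ 2))
    rw [mul_pow]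
    exact mul_le_mul_of_nonneg_left (hBle _) (sq_nonneg _)
  have hWs := summable_zeta a b hab
  have hKs : ∀ (l : ℤ) (T : Finset ℤ),
      ∑ m ∈ T, (Q * (1 / zeta a b m + 1 / zeta a b (l - m))) ^ 2 ≤ 4 * Q ^ 2 * W := by
    intro l T
    have e1 : ∑ m ∈ T, (1 / zeta a b m) ^ 2 ≤ W := hWs.sum_le_tsum T (fun _ _ => sq_nonneg _)
    have e2 : ∑ m ∈ T, (1 / zeta a b (l - m)) ^ 2 ≤ W := by
      have hs' := (Equiv.subLeft l).summable_iff.2 hWs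
      have := hs'.sum_le_tsum T (fun _ _ => sq_nonneg _)
      refine this.trans (le_of_eq ?_)
      exact (Equiv.subLeft l).tsum_eq (fun l => (1 / zeta a b l) ^ 2)
    calc ∑ m ∈ T, (Q * (1 / zeta a b m + 1 / zeta a b (l - m))) ^ 2
        ≤ ∑ m ∈ T, (2 * Q ^ 2 * (1 / zeta a b m) ^ 2 + 2 * Q ^ 2 * (1 / zeta a b (l - m)) ^ 2) := by
          refine Finset.sum_le_sum fun m _ => ?_
          nlinarith [sq_nonneg (Q * (1 / zeta a b m - 1 / zeta a b (l - m)))]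
      _ = 2 * Q ^ 2 * ∑ m ∈ T, (1 / zeta a b m) ^ 2
          + 2 * Q ^ 2 * ∑ m ∈ T, (1 / zeta a b (l - m)) ^ 2 := by
          rw [Finset.sum_add_distrib, Finset.mul_sum, Finset.mul_sum]
      _ ≤ 2 * Q ^ 2 * W + 2 * Q ^ 2 * W := by gcongr
      _ = _ := by ring
  have hpt : ∀ l, (zeta a b l ^ σ * ‖convC c d l‖) ^ 2 ≤
      4 * Q ^ 2 * W * ∑' m, (A m * B (l - m)) ^ 2 := by
    intro l
    have hz := zr_pos a b σ l
    have hcs := h.conv_summable h' hα hβ l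
    have hT0 : 0 ≤ ∑' m, (A m * B (l - m)) ^ 2 := tsum_nonneg fun _ => sq_nonneg _
    have h1 : zeta a b l ^ σ * ‖convC c d l‖ ≤ ∑' m, zeta a b l ^ σ * ‖c m * d (l - m)‖ := by
      rw [tsum_mul_left]
      exact mul_le_mul_of_nonneg_left (norm_tsum_le_tsum_norm hcs) hz.le
    have h2 : ∑' m, zeta a b l ^ σ * ‖c m * d (l - m)‖ ≤
        Real.sqrt (4 * Q ^ 2 * W * ∑' m, (A m * B (l - m)) ^ 2) := by
      refine Real.tsum_le_of_sum_le (fun m => mul_nonneg hz.le (norm_nonneg _)) fun T => ?_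
      apply Real.le_sqrt_of_sq_le
      calc (∑ m ∈ T, zeta a b l ^ σ * ‖c m * d (l - m)‖) ^ 2
          ≤ (∑ m ∈ T, (Q * (1 / zeta a b m + 1 / zeta a b (l - m))) * (A m * B (l - m))) ^ 2 := by
            refine pow_le_pow_left₀
              (Finset.sum_nonneg fun m _ => mul_nonneg hz.le (norm_nonneg _)) ?_ 2
            refine Finset.sum_le_sum fun m _ => ?_
            refine (mul_le_mul_of_nonneg_right (hk l m) (norm_nonneg _)).trans (le_of_eq ?_)
            rw [norm_mul, hA, hB]
            ring
        _ ≤ (∑ m ∈ T, (Q * (1 / zeta a b m + 1 / zeta a b (l - m))) ^ 2) *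
            ∑ m ∈ T, (A m * B (l - m)) ^ 2 := Finset.sum_mul_sq_le_sq_mul_sq _ _ _
        _ ≤ _ := by
            refine mul_le_mul (hKs l T) ((hABs l).sum_le_tsum T (fun _ _ => sq_nonneg _))
              (Finset.sum_nonneg fun _ _ => sq_nonneg _) (by positivity)
    have h3 := h1.trans h2
    calc _ ≤ _ := pow_le_pow_left₀ (by positivity) h3 2
      _ = _ := Real.sq_sqrt (by positivity)
  calc ∑ l ∈ S, (zeta a b l ^ σ * ‖convC c d l‖) ^ 2
      ≤ ∑ l ∈ S, 4 * Q ^ 2 * W * ∑' m, (A m * B (l - m)) ^ 2 := Finset.sum_le_sum fun l _ => hpt l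
    _ = 4 * Q ^ 2 * W * ∑' m, ∑ l ∈ S, (A m * B (l - m)) ^ 2 := by
        rw [← Finset.mul_sum, Summable.tsum_finsetSum (fun l _ => hABs l)]
    _ ≤ 4 * Q ^ 2 * W * ∑' m, A m ^ 2 * M' ^ 2 := by
        refine mul_le_mul_of_nonneg_left ?_ (by positivity)
        refine Summable.tsum_le_tsum (fun m => ?_) (summable_sum fun l _ => hABs l)
          (hAs.mul_right _)
        simp_rw [mul_pow]
        rw [← Finset.mul_sum]
        refine mul_le_mul_of_nonneg_left ?_ (sq_nonneg _)
        have := h'.2 (S.map (Equiv.subRight m).toEmbedding)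
        rw [Finset.sum_map] at this
        simpa using this
    _ ≤ 4 * Q ^ 2 * W * (M ^ 2 * M' ^ 2) := by
        rw [tsum_mul_right]
        have := h.tsum_le
        gcongr
    _ = _ := by
        rw [mul_pow, mul_pow, mul_pow, Real.sq_sqrt hW0]
        ring

end HB

lemma conv_alg (a b : ℝ) (hab : a < b) (r : ℝ) (hr : 1 ≤ r) : ∃ C : ℝ, 0 ≤ C ∧
    ∀ c d M M', HB a b r c M → HB a b r d M' → HB a b r (convC c d) (C * M * M') := by
  refine ⟨2 * 2 ^ r * Real.sqrt (∑' l, (1 / zeta a b l) ^ 2), by positivity, ?_⟩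
  intro c d M M' h h'
  refine h.conv_aux h' (by linarith) (by linarith) hab (by positivity) fun l m => ?_
  have h1 := one_le_zeta a b m
  have h2 := one_le_zeta a b (l - m)
  have ht := zeta_tri a b l m
  have h0 := zeta_pos a b l
  set x := zeta a b m
  set y := zeta a b (l - m)
  set z := zeta a b l
  have hx : x ≤ x ^ r := by
    simpa using Real.rpow_le_rpow_of_exponent_le h1 hr
  have hy : y ≤ y ^ r := by
    simpa using Real.rpow_le_rpow_of_exponent_le h2 hr
  have hz : z ^ r ≤ 2 ^ r * (x ^ r + y ^ r) := by
    rcases le_total x y with hxy | hxy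
    · calc z ^ r ≤ (2 * y) ^ r := Real.rpow_le_rpow h0.le (by linarith) (by linarith)
        _ = 2 ^ r * y ^ r := Real.mul_rpow (by norm_num) (by linarith)
        _ ≤ _ := by
          refine mul_le_mul_of_nonneg_left ?_ (by positivity)
          linarith
    · calc z ^ r ≤ (2 * x) ^ r := Real.rpow_le_rpow h0.le (by linarith) (by linarith)
        _ = 2 ^ r * x ^ r := Real.mul_rpow (by norm_num) (by linarith)
        _ ≤ _ := by
          refine mul_le_mul_of_nonneg_left ?_ (by positivity)
          linarith
  refine hz.trans ?_
  rw [mul_assoc]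
  refine mul_le_mul_of_nonneg_left ?_ (by positivity)
  have hx0 : 0 < x := by linarith
  have hy0 : 0 < y := by linarith
  have hxr : 0 < x ^ r := by linarith
  have hyr : 0 < y ^ r := by linarith
  have e1 : y ^ r ≤ 1 / x * (x ^ r * y ^ r) := by
    rw [div_mul_eq_mul_div, one_mul, le_div_iff₀ hx0]
    nlinarith
  have e2 : x ^ r ≤ 1 / y * (x ^ r * y ^ r) := by
    rw [div_mul_eq_mul_div, one_mul, le_div_iff₀ hy0]
    nlinarith
  rw [add_mul]
  linarith

lemma zeta_peetre (a b σ : ℝ) (hσ : 0 ≤ σ) (l m : ℤ) :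
    zeta a b l ^ σ ≤ 2 ^ σ * (zeta a b m ^ σ * zeta a b (l - m) ^ σ) := by
  have h1 := one_le_zeta a b m
  have h2 := one_le_zeta a b (l - m)
  have ht := zeta_tri a b l m
  have h0 := zeta_pos a b l
  rw [← Real.mul_rpow (by linarith) (by linarith), ← Real.mul_rpow (by norm_num) (by positivity)]
  refine Real.rpow_le_rpow h0.le ?_ hσ
  nlinarith

lemma conv_low (a b : ℝ) (hab : a < b) (σ : ℝ) (hσ : 0 ≤ σ) : ∃ C : ℝ, 0 ≤ C ∧
    (∀ c d M M', HB a b σ c M → HB a b (σ + 1) d M' → HB a b σ (convC c d) (C * M * M')) ∧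
    (∀ c d M M', HB a b (σ + 1) c M → HB a b σ d M' → HB a b σ (convC c d) (C * M * M')) := by
  refine ⟨2 * 2 ^ σ * Real.sqrt (∑' l, (1 / zeta a b l) ^ 2), by positivity, ?_, ?_⟩
  · intro c d M M' h h'
    refine h.conv_aux h' hσ (by linarith) hab (by positivity) fun l m => ?_
    refine (zeta_peetre a b σ hσ l m).trans ?_
    rw [mul_assoc]
    refine mul_le_mul_of_nonneg_left ?_ (by positivity)
    have hx0 := zeta_pos a b m
    have hy0 := zeta_pos a b (l - m)
    have hx := zr_pos a b σ m
    have hy := zr_pos a b σ (l - m)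
    rw [Real.rpow_add hy0, Real.rpow_one]
    calc _ = 1 / zeta a b (l - m) * (zeta a b m ^ σ * (zeta a b (l - m) ^ σ * zeta a b (l - m))) := by
          field_simp
      _ ≤ _ := by
          refine mul_le_mul_of_nonneg_right ?_ (by positivity)
          have : 0 < 1 / zeta a b m := by positivity
          linarith
  · intro c d M M' h h'
    refine h.conv_aux h' (by linarith) hσ hab (by positivity) fun l m => ?_
    refine (zeta_peetre a b σ hσ l m).trans ?_
    rw [mul_assoc]
    refine mul_le_mul_of_nonneg_left ?_ (by positivity)
    have hx0 := zeta_pos a b m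
    have hy0 := zeta_pos a b (l - m)
    have hx := zr_pos a b σ m
    have hy := zr_pos a b σ (l - m)
    rw [Real.rpow_add hx0, Real.rpow_one]
    calc _ = 1 / zeta a b m * (zeta a b m ^ σ * zeta a b m * zeta a b (l - m) ^ σ) := by
          field_simp
      _ ≤ _ := by
          refine mul_le_mul_of_nonneg_right ?_ (by positivity)
          have : 0 < 1 / zeta a b (l - m) := by positivity
          linarith

lemma convC_sub_left {c c' d : ℤ → ℂ} {l : ℤ} (h : Summable fun m => ‖c m * d (l - m)‖)
    (h' : Summable fun m => ‖c' m * d (l - m)‖) :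
    convC (fun m => c m - c' m) d l = convC c d l - convC c' d l := by
  unfold convC
  rw [← Summable.tsum_sub h.of_norm h'.of_norm]
  exact tsum_congr fun m => by ring

lemma convC_sub_right {c d d' : ℤ → ℂ} {l : ℤ} (h : Summable fun m => ‖c m * d (l - m)‖)
    (h' : Summable fun m => ‖c m * d' (l - m)‖) :
    convC c (fun m => d m - d' m) l = convC c d l - convC c d' l := by
  unfold convC
  rw [← Summable.tsum_sub h.of_norm h'.of_norm]
  exact tsum_congr fun m => by ring

lemma HB.sub_left {a b s : ℝ} {c c' d : ℤ → ℂ} {M M' N : ℝ} (hs : 0 ≤ s) (h : HB a b s c M)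
    (h' : HB a b s c' M') (hd : HB a b s d N) (l : ℤ) :
    convC (fun m => c m - c' m) d l = convC c d l - convC c' d l :=
  convC_sub_left (h.conv_summable hd hs hs l) (h'.conv_summable hd hs hs l)

lemma HB.sub_right {a b s : ℝ} {c d d' : ℤ → ℂ} {M M' N : ℝ} (hs : 0 ≤ s) (h : HB a b s c N)
    (hd : HB a b s d M) (hd' : HB a b s d' M') (l : ℤ) :
    convC c (fun m => d m - d' m) l = convC c d l - convC c d' l :=
  convC_sub_right (h.conv_summable hd hs hs l) (h.conv_summable hd' hs hs l)

lemma convC_smul_left (k : ℂ) (c d : ℤ → ℂ) (l : ℤ) :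
    convC (fun m => k * c m) d l = k * convC c d l := by
  unfold convC
  rw [← tsum_mul_left]
  exact tsum_congr fun m => by ring

lemma convC_smul_right (k : ℂ) (c d : ℤ → ℂ) (l : ℤ) :
    convC c (fun m => k * d m) l = k * convC c d l := by
  unfold convC
  rw [← tsum_mul_left]
  exact tsum_congr fun m => by ring

lemma HB_one (a b σ : ℝ) : HB a b σ oneC 1 := by
  refine ⟨zero_le_one, fun S => ?_⟩
  calc ∑ l ∈ S, (zeta a b l ^ σ * ‖oneC l‖) ^ 2 = ∑ l ∈ S, if l = 0 then (1 : ℝ) else 0 := by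
        refine Finset.sum_congr rfl fun l _ => ?_
        by_cases h : l = 0
        · simp [h, oneC, zeta_zero]
        · simp [h, oneC]
    _ ≤ 1 ^ 2 := by
        rw [Finset.sum_ite_eq']
        split_ifs <;> norm_num

lemma HB_zero (a b σ : ℝ) : HB a b σ (fun _ => 0) 0 := by
  refine ⟨le_rfl, fun S => ?_⟩
  simp

lemma pow_bound (a b : ℝ) (hab : a < b) (r : ℝ) (hr : 1 ≤ r) (M : ℝ) (n : ℕ) : ∃ C : ℝ, 0 ≤ C ∧
    ∀ c, HB a b r c M → HB a b r (powC c n) C := by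
  obtain ⟨Q, hQ, H⟩ := conv_alg a b hab r hr
  induction n with
  | zero => exact ⟨1, zero_le_one, fun c _ => HB_one a b r⟩
  | succ n ih =>
    obtain ⟨C, hC, ih⟩ := ih
    by_cases hM : 0 ≤ M
    · exact ⟨Q * M * C, by positivity, fun c h => H _ _ _ _ h (ih c h)⟩
    · exact ⟨0, le_rfl, fun c h => absurd h.1 hM⟩

lemma pow_lip (a b : ℝ) (hab : a < b) (r : ℝ) (hr : 1 ≤ r) (M : ℝ) (hM : 0 ≤ M) (n : ℕ) :
    ∃ C : ℝ, 0 ≤ C ∧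
    ∀ c d δ, HB a b r c M → HB a b r d M → HB a b r (fun l => c l - d l) δ →
      HB a b r (fun l => powC c n l - powC d n l) (C * δ) := by
  obtain ⟨Q, hQ, H⟩ := conv_alg a b hab r hr
  have hr0 : 0 ≤ r := by linarith
  induction n with
  | zero =>
    refine ⟨0, le_rfl, fun c d δ _ _ _ => ?_⟩
    simpa [powC] using HB_zero a b r
  | succ n ih =>
    obtain ⟨C, hC, ih⟩ := ih
    obtain ⟨P, hP, hb⟩ := pow_bound a b hab r hr M n
    refine ⟨Q * P + Q * M * C, by positivity, fun c d δ h h' hd => ?_⟩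
    have h1 := H _ _ _ _ hd (hb c h)
    have h2 := H _ _ _ _ h' (ih c d δ h h' hd)
    have := h1.add h2
    have e : Q * δ * P + Q * M * (C * δ) = (Q * P + Q * M * C) * δ := by ring
    rw [e] at this
    convert this using 2 with l
    rw [convC_sub_left (h.conv_summable (hb c h) hr0 hr0 l)
      (h'.conv_summable (hb c h) hr0 hr0 l),
      convC_sub_right (h'.conv_summable (hb c h) hr0 hr0 l)
      (h'.conv_summable (hb d h') hr0 hr0 l)]
    simp only [powC]
    ring

lemma pow_taylor (a b : ℝ) (hab : a < b) (s : ℝ) (hs : 1 ≤ s) (M : ℝ) (hM : 0 ≤ M) (n : ℕ) :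
    ∃ C : ℝ, 0 ≤ C ∧
    ∀ u0 u1, HB a b s u0 M → HB a b s u1 M → ∃ B, HB a b s B C ∧
      ∀ (u : ℤ → ℂ) (t : ℝ), 0 ≤ t → HB a b s u M → HB a b s (fun l => u l - u0 l) (M * t) →
        HB a b (s - 1) (fun l => u l - u0 l - t * u1 l) (M * t ^ 2) →
        HB a b (s - 1) (fun l => powC u n l - powC u0 n l - t * B l) (C * t ^ 2) := by
  obtain ⟨Q, hQ, H⟩ := conv_alg a b hab s hs
  obtain ⟨q, hq, L1, L2⟩ := conv_low a b hab (s - 1) (by linarith)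
  have hr0 : 0 ≤ s := by linarith
  have hr1 : 0 ≤ s - 1 := by linarith
  rw [sub_add_cancel] at L1 L2
  induction n with
  | zero =>
    refine ⟨0, le_rfl, fun u0 u1 _ _ => ⟨fun _ => 0, HB_zero a b s, fun u t _ _ _ _ => ?_⟩⟩
    simpa [powC] using HB_zero a b (s - 1)
  | succ n ih =>
    obtain ⟨C, hC, ih⟩ := ih
    obtain ⟨P, hP, hb⟩ := pow_bound a b hab s hs M n
    obtain ⟨Λ, hΛ, hl⟩ := pow_lip a b hab s hs M hM n
    refine ⟨(Q * M * P + Q * M * C) + (q * M * C + q * M * P + Q * M * (Λ * M)),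
      by positivity, fun u0 u1 h0 h1 => ?_⟩
    obtain ⟨B, hB, ih⟩ := ih u0 u1 h0 h1
    have hP0 := hb u0 h0
    refine ⟨fun l => convC u1 (powC u0 n) l + convC u0 B l, ?_, ?_⟩
    · refine ((H _ _ _ _ h1 hP0).add (H _ _ _ _ h0 hB)).mono ?_
      have : 0 ≤ (q * M * C + q * M * P + Q * M * (Λ * M)) := by positivity
      linarith
    · intro u t ht hu hd hr
      have hR := ih u t ht hu hd hr
      have hPu := hb u hu
      have a1 := L2 _ _ _ _ h0 hR
      have a2 := L1 _ _ _ _ hr hP0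
      have hdd := hl u u0 _ hu h0 hd
      have a3 := (H _ _ _ _ hd hdd).lower (show s - 1 ≤ s by linarith)
      have a4 := ((a1.add a2).add a3).mono (M' := ((Q * M * P + Q * M * C) +
        (q * M * C + q * M * P + Q * M * (Λ * M))) * t ^ 2) (by
          have : 0 ≤ (Q * M * P + Q * M * C) * t ^ 2 := by positivity
          nlinarith)
      convert a4 using 2 with l
      have htB : HB a b s (fun l => (t : ℂ) * B l) _ := hB.smul t
      have htu : HB a b s (fun l => (t : ℂ) * u1 l) _ := h1.smul t
      have hPd : HB a b s (fun l => powC u n l - powC u0 n l) _ := hPu.sub hP0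
      rw [HB.sub_right hr0 h0 hPd htB l, HB.sub_right hr0 h0 hPu hP0 l,
        HB.sub_left hr0 hd htu hP0 l, HB.sub_left hr0 hu h0 hP0 l,
        HB.sub_right hr0 hd hPu hP0 l, HB.sub_left hr0 hu h0 hPu l, HB.sub_left hr0 hu h0 hP0 l,
        convC_smul_left, convC_smul_right]
      simp only [powC]
      ring

/-- Mean value inequality in `H^σ`, for coefficientwise derivatives. -/
lemma HB_mvt (a b σ : ℝ) (f f' : ℝ → ℤ → ℂ) (τ M : ℝ) (hτ : 0 ≤ τ) (hM : 0 ≤ M)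
    (hd : ∀ t, 0 ≤ t → t ≤ τ → ∀ l, HasDerivAt (fun x => f x l) (f' t l) t)
    (hb : ∀ t, 0 ≤ t → t ≤ τ → HB a b σ (f' t) M) :
    HB a b σ (fun l => f τ l - f 0 l) (M * τ) := by
  refine ⟨by positivity, fun S => ?_⟩
  let g : ℝ → EuclideanSpace ℂ S := fun t => WithLp.toLp 2 fun l => (zeta a b l ^ σ : ℝ) * f t l
  let g' : ℝ → EuclideanSpace ℂ S := fun t => WithLp.toLp 2 fun l => (zeta a b l ^ σ : ℝ) * f' t l
  have hg : ∀ t ∈ Set.Icc 0 τ, HasDerivWithinAt g (g' t) (Set.Icc 0 τ) t := by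
    intro t ht
    have : HasDerivAt (fun t => fun l : S => ((zeta a b l ^ σ : ℝ) : ℂ) * f t l)
        (fun l : S => ((zeta a b l ^ σ : ℝ) : ℂ) * f' t l) t :=
      hasDerivAt_pi.2 fun l => (hd t ht.1 ht.2 l).const_mul _
    have h2 := ((PiLp.continuousLinearEquiv 2 ℝ (fun _ : S => ℂ)).symm :
      (S → ℂ) →L[ℝ] PiLp 2 (fun _ : S => ℂ)).hasFDerivAt.comp_hasDerivAt t this
    exact h2.hasDerivWithinAt
  have hsum : ∀ (c : ℤ → ℂ), ‖(WithLp.toLp 2 fun l : S => ((zeta a b l ^ σ : ℝ) : ℂ) * c l :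
      EuclideanSpace ℂ S)‖ ^ 2 = ∑ l ∈ S, (zeta a b l ^ σ * ‖c l‖) ^ 2 := by
    intro c
    rw [EuclideanSpace.norm_sq_eq, ← Finset.sum_coe_sort S]
    refine Finset.sum_congr rfl fun l _ => ?_
    simp [abs_of_pos (zr_pos a b σ l), mul_pow]
  have := norm_image_sub_le_of_norm_deriv_le_segment' hg (C := M) (fun t ht => by
    refine abs_le_of_sq_le_sq' ?_ hM |>.2
    rw [hsum]
    exact (hb t ht.1 ht.2.le).2 S) τ ⟨hτ, le_rfl⟩
  rw [sub_zero] at this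
  rw [← hsum]
  refine pow_le_pow_left₀ (norm_nonneg _) ?_ 2
  have e : (WithLp.toLp 2 fun l : S => ((zeta a b l ^ σ : ℝ) : ℂ) * (f τ l - f 0 l) :
      EuclideanSpace ℂ S) = g τ - g 0 := by
    ext l
    simp [g, mul_sub]
  rw [e]
  exact this

lemma zr_succ (a b σ : ℝ) (l : ℤ) : zeta a b l ^ (σ + 1) = zeta a b l ^ σ * zeta a b l := by
  rw [Real.rpow_add (zeta_pos a b l), Real.rpow_one]

lemma HB.mult {a b σ : ℝ} {c : ℤ → ℂ} {M Q : ℝ} (h : HB a b σ c M) (k : ℤ → ℂ) (hQ : 0 ≤ Q)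
    (hk : ∀ l, ‖k l‖ ≤ Q) : HB a b σ (fun l => k l * c l) (Q * M) := by
  refine h.of_le hQ fun l => ?_
  have := zr_pos a b σ l
  rw [norm_mul]
  calc _ = ‖k l‖ * (zeta a b l ^ σ * ‖c l‖) := by ring
    _ ≤ _ := mul_le_mul_of_nonneg_right (hk l) (by positivity)

lemma HB.mult1 {a b σ : ℝ} {c : ℤ → ℂ} {M : ℝ} (h : HB a b σ c M) (k : ℤ → ℂ)
    (hk : ∀ l, ‖k l‖ ≤ 1) : HB a b σ (fun l => k l * c l) M := by
  simpa using h.mult k zero_le_one hk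

lemma HB.jinv {a b σ : ℝ} {c : ℤ → ℂ} {M : ℝ} (h : HB a b σ c M) :
    HB a b (σ + 1) (fun l => c l / (zeta a b l : ℂ)) M := by
  have := h.of_le (σ := σ + 1) (c := fun l => c l / (zeta a b l : ℂ)) zero_le_one fun l => ?_
  · simpa using this
  · have h0 := zeta_pos a b l
    rw [zr_succ, norm_div, Complex.norm_real, Real.norm_of_nonneg h0.le, one_mul]
    apply le_of_eq
    field_simp

lemma HB.j {a b σ : ℝ} {c : ℤ → ℂ} {M : ℝ} (h : HB a b (σ + 1) c M) :
    HB a b σ (fun l => (zeta a b l : ℂ) * c l) M := by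
  have := h.of_le (σ := σ) (c := fun l => (zeta a b l : ℂ) * c l) zero_le_one fun l => ?_
  · simpa using this
  · have h0 := zeta_pos a b l
    rw [zr_succ, norm_mul, Complex.norm_real, Real.norm_of_nonneg h0.le, one_mul]
    apply le_of_eq
    ring

lemma conjC_convC (c d : ℤ → ℂ) : conjC (convC c d) = convC (conjC c) (conjC d) := by
  funext l
  unfold conjC convC
  rw [Complex.conj_tsum, ← (Equiv.neg ℤ).tsum_eq]
  refine tsum_congr fun m => ?_
  simp only [Equiv.neg_apply, map_mul]
  congr 3
  ring

lemma conjC_reC (c : ℤ → ℂ) : conjC (reC c) = reC c := by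
  funext l
  have h2 : (starRingEnd ℂ) 2 = 2 := Complex.conj_ofNat 2
  simp [conjC, reC, add_comm, h2]

lemma conjC_oneC : conjC oneC = oneC := by
  funext l
  by_cases h : l = 0 <;> simp [conjC, oneC, h]

lemma conjC_powC (c : ℤ → ℂ) (h : conjC c = c) (n : ℕ) : conjC (powC c n) = powC c n := by
  induction n with
  | zero => exact conjC_oneC
  | succ n ih => simp only [powC]; rw [conjC_convC, h, ih]

lemma conj_Gop (p : ℕ) (c : ℤ → ℂ) (l : ℤ) :
    (starRingEnd ℂ) (Gop p c (-l)) = Gop p c l :=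
  congrFun (conjC_powC (reC c) (conjC_reC c) (p + 1)) l

lemma hasDerivAt_reC {f : ℝ → ℤ → ℂ} {f' : ℤ → ℂ} {t : ℝ}
    (h : ∀ l, HasDerivAt (fun x => f x l) (f' l) t) (l : ℤ) :
    HasDerivAt (fun x => reC (f x) l) (reC f' l) t := by
  unfold reC conjC
  exact ((h l).add ((h (-l)).star)).div_const 2

lemma reC_Fop (a b : ℝ) (p : ℕ) (c : ℤ → ℂ) (l : ℤ) : reC (Fop a b p c) l = 0 := by
  unfold reC conjC Fop opJinv
  rw [map_mul, map_div₀, conj_Gop, zeta_neg, Complex.conj_ofReal, Complex.conj_I]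
  ring

/-- `Re (i⟨∇⟩⁻¹ e^{ix⟨∇⟩} G)` is `O(x)`. -/
lemma reC_exp_le (a b : ℝ) (p : ℕ) (x : ℝ) (c : ℤ → ℂ) (l : ℤ) :
    ‖reC (expJ a b x (Fop a b p c)) l‖ ≤ |x| * ‖Gop p c l‖ := by
  have h0 := zeta_pos a b l
  have hne : (zeta a b l : ℂ) ≠ 0 := by exact_mod_cast h0.ne'
  have e1 : (starRingEnd ℂ) (Complex.exp (Complex.I * (x : ℂ) * (zeta a b l : ℂ))) =
      Complex.exp (-(Complex.I * (x : ℂ) * (zeta a b l : ℂ))) := by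
    rw [← Complex.exp_conj]
    congr 1
    simp
  have e2 : reC (expJ a b x (Fop a b p c)) l =
      Complex.exp (-(Complex.I * (x : ℂ) * (zeta a b l : ℂ))) *
      (Complex.exp (Complex.I * ((2 * x * zeta a b l : ℝ) : ℂ)) - 1) *
        (Complex.I / 2 * (Gop p c l / (zeta a b l : ℂ))) := by
    unfold reC conjC expJ Fop opJinv
    rw [map_mul, zeta_neg, e1, map_mul, map_div₀, conj_Gop, Complex.conj_ofReal, Complex.conj_I]
    have : Complex.exp (Complex.I * ((2 * x * zeta a b l : ℝ) : ℂ)) =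
        Complex.exp (Complex.I * (x : ℂ) * (zeta a b l : ℂ)) *
        Complex.exp (Complex.I * (x : ℂ) * (zeta a b l : ℂ)) := by
      rw [← Complex.exp_add]
      congr 1
      push_cast
      ring
    have h4 : Complex.exp (-(Complex.I * (x : ℂ) * (zeta a b l : ℂ))) *
        Complex.exp (Complex.I * (x : ℂ) * (zeta a b l : ℂ)) = 1 := by
      rw [← Complex.exp_add, neg_add_cancel, Complex.exp_zero]
    rw [this]
    linear_combination (- Complex.exp (Complex.I * (x : ℂ) * (zeta a b l : ℂ)) *
      (Complex.I / 2 * (Gop p c l / (zeta a b l : ℂ)))) * h4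
  have e3 : ‖Complex.exp (-(Complex.I * (x : ℂ) * (zeta a b l : ℂ)))‖ = 1 := by
    rw [show -(Complex.I * (x : ℂ) * (zeta a b l : ℂ)) =
      Complex.I * ((-x * zeta a b l : ℝ) : ℂ) by push_cast; ring, Complex.norm_exp_I_mul_ofReal]
  rw [e2, norm_mul, norm_mul, e3, one_mul]
  have h4 := Real.norm_exp_I_mul_ofReal_sub_one_le (x := 2 * x * zeta a b l)
  rw [norm_mul, norm_div, norm_div, Complex.norm_real, Complex.norm_I, Real.norm_of_nonneg h0.le]
  refine (mul_le_mul_of_nonneg_right h4 (by positivity)).trans (le_of_eq ?_)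
  rw [Real.norm_eq_abs, abs_mul, abs_mul, abs_of_pos h0]
  simp
  field_simp

lemma exp_bd (X : ℝ) (hX : 0 ≤ X) :
    ‖Complex.exp (-(Complex.I * X)) - 1 + Complex.I * X * Complex.exp (-(Complex.I * X))‖
      ≤ X ^ 2 := by
  have h1 : ∀ t ∈ Set.Icc 0 X, HasDerivWithinAt
      (fun x : ℝ => Complex.exp (Complex.I * x) - 1 - Complex.I * x)
      (Complex.I * (Complex.exp (Complex.I * t) - 1)) (Set.Icc 0 X) t := by
    intro t _
    have h0 : HasDerivAt (fun x : ℝ => Complex.I * (x : ℂ)) (Complex.I * 1) t :=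
      (Complex.ofRealCLM.hasDerivAt).const_mul _
    have := ((h0.cexp.sub_const 1).sub h0)
    refine (this.congr_deriv ?_).hasDerivWithinAt
    ring
  have h2 := norm_image_sub_le_of_norm_deriv_le_segment' h1 (C := X) (fun t ht => by
    rw [norm_mul, Complex.norm_I, one_mul]
    refine Real.norm_exp_I_mul_ofReal_sub_one_le.trans ?_
    rw [Real.norm_of_nonneg ht.1]
    exact ht.2.le) X ⟨hX, le_rfl⟩
  have e : Complex.exp (-(Complex.I * X)) - 1 + Complex.I * X * Complex.exp (-(Complex.I * X)) =
      - Complex.exp (Complex.I * ((-X : ℝ) : ℂ)) *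
        (Complex.exp (Complex.I * X) - 1 - Complex.I * X) := by
    have h3 : Complex.exp (Complex.I * ((-X : ℝ) : ℂ)) = Complex.exp (-(Complex.I * X)) := by
      congr 1; push_cast; ring
    have h4 : Complex.exp (-(Complex.I * X)) * Complex.exp (Complex.I * X) = 1 := by
      rw [← Complex.exp_add, neg_add_cancel, Complex.exp_zero]
    rw [h3]
    linear_combination h4
  rw [e, norm_mul, norm_neg, Complex.norm_exp_I_mul_ofReal, one_mul]
  simp at h2
  rw [sq]
  simpa using h2

lemma norm_expJ_mult (a b x : ℝ) (l : ℤ) :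
    ‖Complex.exp (Complex.I * (x : ℂ) * (zeta a b l : ℂ))‖ = 1 := by
  rw [mul_assoc, ← Complex.ofReal_mul, Complex.norm_exp_I_mul_ofReal]

lemma norm_expJ_mult_neg (a b x : ℝ) (l : ℤ) :
    ‖Complex.exp (-(Complex.I * (x : ℂ) * (zeta a b l : ℂ)))‖ = 1 := by
  have := norm_expJ_mult a b (-x) l
  rw [← this]
  congr 2
  push_cast
  ring

lemma HB.expJ {a b σ : ℝ} {c : ℤ → ℂ} {M : ℝ} (h : HB a b σ c M) (x : ℝ) :
    HB a b σ (expJ a b x c) M :=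
  h.mult1 _ fun l => (norm_expJ_mult a b x l).le

lemma sol_re (a b : ℝ) (p : ℕ) (ε : ℝ) (ψ : ℝ → ℤ → ℂ) (hψ : IsExactSol a b p ε ψ)
    (t : ℝ) (l : ℤ) :
    HasDerivAt (fun x => reC (ψ x) l)
      (reC (fun m => Complex.I * ((zeta a b m : ℂ) * ψ t m)) l) t := by
  refine (hasDerivAt_reC (hψ t) l).congr_deriv ?_
  simp only [reC, conjC, map_mul, map_add, map_div₀, conj_Gop, zeta_neg, Complex.conj_ofReal,
    Complex.conj_I, map_pow]
  ring

lemma sol_re2 (a b : ℝ) (p : ℕ) (ε : ℝ) (ψ : ℝ → ℤ → ℂ) (hψ : IsExactSol a b p ε ψ)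
    (t : ℝ) (l : ℤ) :
    HasDerivAt (fun x => reC (fun m => Complex.I * ((zeta a b m : ℂ) * ψ x m)) l)
      (reC (fun m => (-1) * ((zeta a b m : ℂ) * ((zeta a b m : ℂ) * ψ t m))
        - (ε ^ p : ℂ) * Gop p (ψ t) m) l) t := by
  refine hasDerivAt_reC (fun l => ?_) l
  have hne : (zeta a b l : ℂ) ≠ 0 := by exact_mod_cast (zeta_pos a b l).ne'
  refine (((hψ t l).const_mul (zeta a b l : ℂ)).const_mul Complex.I).congr_deriv ?_
  field_simp
  rw [Complex.I_sq]
  ring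

/-- Closeness of the real parts at the end of the step. -/
lemma re_close (a b : ℝ) (p : ℕ) (σ ε τ N : ℝ) (hε : 0 < ε) (hτ : 0 < τ)
    (ψ : ℝ → ℤ → ℂ) (hψ : IsExactSol a b p ε ψ)
    (hG : ∀ t, 0 ≤ t → t ≤ τ → HB a b σ (Gop p (ψ t)) N) :
    HB a b σ (fun l => reC (expJ a b τ (flowV a b p ε (τ / 2) (ψ 0))) l - reC (ψ τ) l)
      (2 * N * ε ^ p * τ ^ 2) := by
  have hN : 0 ≤ N := (hG 0 le_rfl hτ.le).1
  have hnε : ‖(ε ^ p : ℂ)‖ = ε ^ p := by simp [abs_of_pos hε]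
  have h1 := HB_mvt a b σ (fun t l => reC (expJ a b (τ - t) (ψ t)) l)
    (fun t l => (ε ^ p : ℂ) * reC (expJ a b (τ - t) (Fop a b p (ψ t))) l) τ (ε ^ p * (τ * N)) hτ.le
    (by positivity) (by
      intro t ht htτ l
      have hd : ∀ l, HasDerivAt (fun x => expJ a b (τ - x) (ψ x) l)
          ((ε ^ p : ℂ) * expJ a b (τ - t) (Fop a b p (ψ t)) l) t := by
        intro l
        unfold expJ Fop opJinv
        have h0 : HasDerivAt (fun x : ℝ => Complex.I * ((τ - x : ℝ) : ℂ) * (zeta a b l : ℂ))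
            (Complex.I * ((-1 : ℝ) : ℂ) * (zeta a b l : ℂ)) t :=
          ((((hasDerivAt_id t).const_sub τ).ofReal_comp).const_mul Complex.I).mul_const _
        refine (h0.cexp.mul (hψ t l)).congr_deriv ?_
        push_cast
        ring
      refine (hasDerivAt_reC hd l).congr_deriv ?_
      simp only [reC, conjC, map_mul, map_pow, Complex.conj_ofReal]
      ring)
    (by
      intro t ht htτ
      have e : HB a b σ (reC (expJ a b (τ - t) (Fop a b p (ψ t)))) (τ * N) := by
        refine (hG t ht htτ).of_le hτ.le fun l => ?_
        have hz := zr_pos a b σ l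
        have := reC_exp_le a b p (τ - t) (ψ t) l
        rw [abs_of_nonneg (by linarith)] at this
        have h3 : (τ - t) * ‖Gop p (ψ t) l‖ ≤ τ * ‖Gop p (ψ t) l‖ :=
          mul_le_mul_of_nonneg_right (by linarith) (norm_nonneg _)
        calc _ ≤ zeta a b l ^ σ * (τ * ‖Gop p (ψ t) l‖) :=
              mul_le_mul_of_nonneg_left (this.trans h3) hz.le
          _ = _ := by ring
      have := e.smul (ε ^ p : ℂ)
      rwa [hnε] at this)
  have h2 : HB a b σ (reC (expJ a b τ (Fop a b p (ψ 0)))) (τ * N) := by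
    refine (hG 0 le_rfl hτ.le).of_le hτ.le fun l => ?_
    have hz := zr_pos a b σ l
    have := reC_exp_le a b p τ (ψ 0) l
    rw [abs_of_pos hτ] at this
    calc _ ≤ zeta a b l ^ σ * (τ * ‖Gop p (ψ 0) l‖) := mul_le_mul_of_nonneg_left this hz.le
      _ = _ := by ring
  have h3 := h2.smul ((ε ^ p * (τ / 2) : ℝ) : ℂ)
  have h4 := (h3.sub h1).mono (M' := 2 * N * ε ^ p * τ ^ 2) (by
    rw [Complex.norm_real, Real.norm_of_nonneg (by positivity)]
    have : 0 ≤ ε ^ p * N * τ ^ 2 := by positivity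
    nlinarith)
  convert h4 using 2 with l
  simp only [reC, conjC, expJ, flowV, sub_self, sub_zero, map_mul, map_add, Complex.real_smul,
    Complex.conj_ofReal, Complex.ofReal_zero, mul_zero, zero_mul, Complex.exp_zero, one_mul]
  ring

/-- Derivative estimate for the trapezoidal error functional. -/
lemma trap (a b : ℝ) (p : ℕ) (s ε τ N N' : ℝ) (hε : 0 < ε) (hτ : 0 < τ)
    (ψ : ℝ → ℤ → ℂ) (hψ : IsExactSol a b p ε ψ) (B : ℤ → ℂ)
    (hA : HB a b (s + 1) (Gop p (ψ 0)) N) (hB : HB a b s B N')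
    (hR : ∀ t, 0 ≤ t → t ≤ τ →
      HB a b (s - 1) (fun l => Gop p (ψ t) l - Gop p (ψ 0) l - t * B l) (N' * t ^ 2)) :
    HB a b s (fun l => Complex.exp (-(Complex.I * (τ : ℂ) * (zeta a b l : ℂ))) * ψ τ l - ψ 0 l -
      (ε ^ p : ℂ) * Complex.I / (zeta a b l : ℂ) * (τ / 2) * (Gop p (ψ 0) l +
        Complex.exp (-(Complex.I * (τ : ℂ) * (zeta a b l : ℂ))) * (Gop p (ψ 0) l + τ * B l)))
      ((2 * N' + N) * ε ^ p * τ ^ 3) := by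
  have hN : 0 ≤ N := hA.1
  have hN' : 0 ≤ N' := hB.1
  have hnε : ‖(ε ^ p : ℂ)‖ = ε ^ p := by simp [abs_of_pos hε]
  set A := Gop p (ψ 0) with hAdef
  have h1 := HB_mvt a b s (fun t l =>
    Complex.exp (-(Complex.I * (t : ℂ) * (zeta a b l : ℂ))) * ψ t l -
      (ε ^ p : ℂ) * Complex.I / (zeta a b l : ℂ) * (((t : ℂ) / 2) * (A l +
        Complex.exp (-(Complex.I * (t : ℂ) * (zeta a b l : ℂ))) * (A l + t * B l))))
    (fun t l => (ε ^ p : ℂ) * (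
      (Complex.exp (-(Complex.I * (t : ℂ) * (zeta a b l : ℂ))) * Complex.I) *
        ((Gop p (ψ t) l - A l - t * B l) / (zeta a b l : ℂ))
      + (Complex.I / 2 * ((Complex.exp (-(Complex.I * (t : ℂ) * (zeta a b l : ℂ))) - 1 +
          Complex.I * t * zeta a b l * Complex.exp (-(Complex.I * (t : ℂ) * (zeta a b l : ℂ))))
            / (zeta a b l : ℂ) ^ 2)) * ((zeta a b l : ℂ) * A l)
      + (-(t : ℂ) ^ 2 / 2 * Complex.exp (-(Complex.I * (t : ℂ) * (zeta a b l : ℂ)))) * B l))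
    τ (ε ^ p * (N' * τ ^ 2 + τ ^ 2 * N + τ ^ 2 * N')) hτ.le (by positivity) (by
      intro t ht htτ l
      have hne : (zeta a b l : ℂ) ≠ 0 := by exact_mod_cast (zeta_pos a b l).ne'
      have hid : HasDerivAt (fun x : ℝ => (x : ℂ)) 1 t := by
        simpa using (hasDerivAt_id t).ofReal_comp
      have hth := ((hid.const_mul Complex.I).mul_const (zeta a b l : ℂ)).neg.cexp
      have hpoly := (hid.mul_const (B l)).const_add (A l)
      have hp2 := (hth.mul hpoly).const_add (A l)
      have hp3 := ((hid.div_const 2).mul hp2).const_mul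
        ((ε ^ p : ℂ) * Complex.I / (zeta a b l : ℂ))
      have := (hth.mul (hψ t l)).sub hp3
      refine this.congr_deriv ?_
      simp only [Pi.neg_apply, Pi.mul_apply, Pi.add_apply]
      generalize Complex.exp (-(Complex.I * (t : ℂ) * (zeta a b l : ℂ))) = θ
      field_simp
      ring_nf
      try simp only [Complex.I_sq]
      try ring)
    (by
      intro t ht htτ
      have ht2 : t ^ 2 ≤ τ ^ 2 := pow_le_pow_left₀ ht htτ 2
      have b1 := (hR t ht htτ).jinv
      rw [sub_add_cancel] at b1
      have b1' := (b1.mult1 (fun l => Complex.exp (-(Complex.I * (t : ℂ) * (zeta a b l : ℂ)))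
        * Complex.I) (fun l => by
          rw [norm_mul, norm_expJ_mult_neg, Complex.norm_I, one_mul])).mono
          (M' := N' * τ ^ 2) (mul_le_mul_of_nonneg_left ht2 hN')
      have b2 := hA.j.mult (fun l => Complex.I / 2 *
        ((Complex.exp (-(Complex.I * (t : ℂ) * (zeta a b l : ℂ))) - 1 +
          Complex.I * t * zeta a b l * Complex.exp (-(Complex.I * (t : ℂ) * (zeta a b l : ℂ))))
            / (zeta a b l : ℂ) ^ 2)) (Q := τ ^ 2) (by positivity) (fun l => by
          have h0 := zeta_pos a b l
          have hx := exp_bd (t * zeta a b l) (by positivity)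
          rw [Complex.ofReal_mul, ← mul_assoc] at hx
          rw [norm_mul, norm_div, norm_div, Complex.norm_I, norm_pow, Complex.norm_real,
            Real.norm_of_nonneg h0.le]
          have : ‖(Complex.exp (-(Complex.I * (t : ℂ) * (zeta a b l : ℂ))) - 1 +
            Complex.I * t * zeta a b l * Complex.exp (-(Complex.I * (t : ℂ) * (zeta a b l : ℂ))))‖
            / zeta a b l ^ 2 ≤ t ^ 2 := by
            rw [div_le_iff₀ (by positivity), ← mul_pow]
            exact hx
          have h3 : (1 : ℝ) / ‖(2 : ℂ)‖ = 1 / 2 := by norm_num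
          rw [h3]
          nlinarith)
      have b3 := hB.mult (fun l => -(t : ℂ) ^ 2 / 2 *
        Complex.exp (-(Complex.I * (t : ℂ) * (zeta a b l : ℂ)))) (Q := τ ^ 2) (by positivity)
        (fun l => by
          rw [norm_mul, norm_expJ_mult_neg, norm_div, norm_neg, norm_pow, Complex.norm_real,
            Real.norm_of_nonneg ht]
          have h3 : ‖(2 : ℂ)‖ = 2 := by norm_num
          rw [h3]
          nlinarith [sq_nonneg t])
      have := ((b1'.add b2).add b3).smul (ε ^ p : ℂ)
      rwa [hnε] at this)
  have h2 := h1.mono (M' := (2 * N' + N) * ε ^ p * τ ^ 3) (le_of_eq (by ring))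
  convert h2 using 2 with l
  simp only [Complex.ofReal_zero, mul_zero, zero_mul, neg_zero, Complex.exp_zero, one_mul,
    zero_div, sub_zero]
  ring

lemma core (a b : ℝ) (hab : a < b) (p : ℕ) (s : ℝ) (hs : 1 ≤ s) (K : ℝ) (hK : 0 < K) :
    ∃ C > 0, ∀ (ε : ℝ), 0 < ε → ε ≤ 1 → ∀ (τ : ℝ), 0 < τ → τ ≤ 1 / ε ^ p →
      ∀ (ψ : ℝ → ℤ → ℂ), IsExactSol a b p ε ψ →
        (∀ t : ℝ, 0 ≤ t → t ≤ τ → HB a b (s + 1) (ψ t) K) →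
        HB a b s (fun l => strang2 a b p ε τ (ψ 0) l - ψ τ l) (C * ε ^ p * τ ^ 3) := by
  obtain ⟨N, hN, HN⟩ := pow_bound a b hab (s + 1) (by linarith) K (p + 1)
  obtain ⟨T, hT, HT⟩ := pow_taylor a b hab s hs (K + N) (by positivity) (p + 1)
  obtain ⟨Λ, hΛ, HΛ⟩ := pow_lip a b hab s hs (K + N) (by positivity) (p + 1)
  refine ⟨(2 * T + N) + (Λ * (2 * N) + T) + 1, by positivity, ?_⟩
  intro ε hε hε1 τ hτ hτε ψ hψ hb
  have hεp : 0 < ε ^ p := by positivity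
  have hεp1 : ε ^ p ≤ 1 := pow_le_one₀ hε.le hε1
  have hετ : ε ^ p * τ ≤ 1 := by
    rw [le_div_iff₀ hεp] at hτε
    linarith
  have hnε : ‖(ε ^ p : ℂ)‖ = ε ^ p := by simp [abs_of_pos hε]
  have hG : ∀ t, 0 ≤ t → t ≤ τ → HB a b (s + 1) (Gop p (ψ t)) N :=
    fun t h1 h2 => HN _ (hb t h1 h2).reC
  have hGs : ∀ t, 0 ≤ t → t ≤ τ → HB a b s (Gop p (ψ t)) N :=
    fun t h1 h2 => (hG t h1 h2).lower (by linarith)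
  have hu : ∀ t, 0 ≤ t → t ≤ τ → HB a b s (reC (ψ t)) (K + N) :=
    fun t h1 h2 => ((hb t h1 h2).reC.lower (by linarith)).mono (by linarith)
  have hV : ∀ t, 0 ≤ t → t ≤ τ →
      HB a b s (reC (fun m => Complex.I * ((zeta a b m : ℂ) * ψ t m))) K := fun t h1 h2 => by
    have := ((hb t h1 h2).j.smul Complex.I).reC
    rwa [Complex.norm_I, one_mul] at this
  have hdu : ∀ t, 0 ≤ t → t ≤ τ → HB a b s (fun l => reC (ψ t) l - reC (ψ 0) l) ((K + N) * t) := by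
    intro t h1 h2
    refine (HB_mvt a b s (fun t => reC (ψ t)) _ t K h1 hK.le
      (fun x _ _ l => sol_re a b p ε ψ hψ x l)
      (fun x hx hx' => hV x hx (hx'.trans h2))).mono ?_
    nlinarith
  have hdV : ∀ t, 0 ≤ t → t ≤ τ → HB a b (s - 1)
      (fun l => reC (fun m => Complex.I * ((zeta a b m : ℂ) * ψ t m)) l
        - reC (fun m => Complex.I * ((zeta a b m : ℂ) * ψ 0 m)) l) ((K + N) * t) := by
    intro t h1 h2
    refine HB_mvt a b (s - 1) (fun t => reC (fun m => Complex.I * ((zeta a b m : ℂ) * ψ t m))) _ t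
      (K + N) h1 (by positivity) (fun x _ _ l => sol_re2 a b p ε ψ hψ x l) (fun x hx hx' => ?_)
    have g1 : HB a b s (fun m => (zeta a b m : ℂ) * ψ x m) K := (hb x hx (hx'.trans h2)).j
    rw [← sub_add_cancel s 1] at g1
    have g2 := g1.j.smul (-1)
    have g3 := ((hGs x hx (hx'.trans h2)).lower (show s - 1 ≤ s by linarith)).smul (ε ^ p : ℂ)
    refine ((g2.sub g3).reC).mono ?_
    rw [hnε]
    simp only [norm_neg, norm_one, one_mul]
    nlinarith
  have hd2 : ∀ t, 0 ≤ t → t ≤ τ → HB a b (s - 1) (fun l => reC (ψ t) l - reC (ψ 0) l -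
      t * reC (fun m => Complex.I * ((zeta a b m : ℂ) * ψ 0 m)) l) ((K + N) * t ^ 2) := by
    intro t h1 h2
    have := HB_mvt a b (s - 1)
      (fun x l => reC (ψ x) l - (x : ℂ) * reC (fun m => Complex.I * ((zeta a b m : ℂ) * ψ 0 m)) l)
      (fun x l => reC (fun m => Complex.I * ((zeta a b m : ℂ) * ψ x m)) l
        - reC (fun m => Complex.I * ((zeta a b m : ℂ) * ψ 0 m)) l) t ((K + N) * t) h1
        (by positivity) (fun x _ _ l => by
          have hid : HasDerivAt (fun x : ℝ => (x : ℂ)) 1 x := by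
            simpa using (hasDerivAt_id x).ofReal_comp
          refine ((sol_re a b p ε ψ hψ x l).sub (hid.mul_const _)).congr_deriv ?_
          ring)
        (fun x hx hx' => (hdV x hx (hx'.trans h2)).mono (by gcongr))
    have := this.mono (M' := (K + N) * t ^ 2) (le_of_eq (by ring))
    convert this using 2 with l
    simp only [Complex.ofReal_zero, zero_mul]
    ring
  obtain ⟨B, hB, HT⟩ := HT (reC (ψ 0)) (reC (fun m => Complex.I * ((zeta a b m : ℂ) * ψ 0 m)))
    (hu 0 le_rfl hτ.le) ((hV 0 le_rfl hτ.le).mono (by linarith))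
  have hR : ∀ t, 0 ≤ t → t ≤ τ →
      HB a b (s - 1) (fun l => Gop p (ψ t) l - Gop p (ψ 0) l - t * B l) (T * t ^ 2) :=
    fun t h1 h2 => HT (reC (ψ t)) t h1 (hu t h1 h2) (hdu t h1 h2) (hd2 t h1 h2)
  have hE := trap a b p s ε τ N T hε hτ ψ hψ B (hG 0 le_rfl hτ.le) hB hR
  have hcl := re_close a b p s ε τ N hε hτ ψ hψ hGs
  -- the intermediate value
  have hc1 : HB a b s (flowV a b p ε (τ / 2) (ψ 0)) (K + N) := by
    have f1 : HB a b s (Fop a b p (ψ 0)) N := by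
      have := (((hGs 0 le_rfl hτ.le).jinv).lower (show s ≤ s + 1 by linarith)).smul Complex.I
      rwa [Complex.norm_I, one_mul] at this
    have f2 := f1.smul ((ε ^ p * (τ / 2) : ℝ) : ℂ)
    have f3 := (((hb 0 le_rfl hτ.le).lower (show s ≤ s + 1 by linarith)).add f2).mono
      (M' := K + N) (by
        rw [Complex.norm_real, Real.norm_of_nonneg (by positivity)]
        nlinarith)
    convert f3 using 2 with l
    simp only [flowV, Complex.real_smul]
  have hc2 := (hc1.expJ τ).reC
  have hG2 := (HΛ _ _ _ hc2 (hu τ hτ.le le_rfl) hcl).lower (show s - 1 ≤ s by linarith)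
  have hrem := ((hG2.add (hR τ hτ.le le_rfl)).jinv).smul
    ((ε ^ p * (τ / 2) : ℝ) * Complex.I : ℂ)
  rw [sub_add_cancel] at hrem
  have hfin := ((hE.expJ τ).neg.add hrem).mono
    (M' := ((2 * T + N) + (Λ * (2 * N) + T) + 1) * ε ^ p * τ ^ 3) (by
      rw [norm_mul, Complex.norm_I, mul_one, Complex.norm_real,
        Real.norm_of_nonneg (by positivity)]
      have k1 : Λ * (2 * N * ε ^ p * τ ^ 2) ≤ Λ * (2 * N) * τ ^ 2 := by
        have : 0 ≤ Λ * (2 * N) * τ ^ 2 := by positivity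
        nlinarith
      have k2 : ε ^ p * (τ / 2) * (Λ * (2 * N * ε ^ p * τ ^ 2) + T * τ ^ 2) ≤
          ε ^ p * (τ / 2) * ((Λ * (2 * N) + T) * τ ^ 2) := by
        refine mul_le_mul_of_nonneg_left ?_ (by positivity)
        linarith
      have k3 : 0 ≤ ε ^ p * τ ^ 3 * (Λ * (2 * N) + T) := by positivity
      have k4 : 0 ≤ ε ^ p * τ ^ 3 := by positivity
      nlinarith)
  convert hfin using 2 with l
  have hne : (zeta a b l : ℂ) ≠ 0 := by exact_mod_cast (zeta_pos a b l).ne'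
  have hθ : Complex.exp (Complex.I * (τ : ℂ) * (zeta a b l : ℂ)) *
      Complex.exp (-(Complex.I * (τ : ℂ) * (zeta a b l : ℂ))) = 1 := by
    rw [← Complex.exp_add, add_neg_cancel, Complex.exp_zero]
  have e0 : ∀ c, powC (reC c) (p + 1) = Gop p c := fun c => rfl
  rw [e0, e0]
  have e1 : strang2 a b p ε τ (ψ 0) l = Complex.exp (Complex.I * (τ : ℂ) * (zeta a b l : ℂ)) *
      (ψ 0 l + (ε ^ p * (τ / 2)) * (Complex.I * (Gop p (ψ 0) l / zeta a b l))) +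
      (ε ^ p * (τ / 2)) * (Complex.I *
        (Gop p (expJ a b τ (flowV a b p ε (τ / 2) (ψ 0))) l / zeta a b l)) := by
    unfold strang2
    generalize hc : expJ a b τ (flowV a b p ε (τ / 2) (ψ 0)) = c2
    simp only [flowV, Complex.real_smul, Fop, opJinv]
    rw [← hc]
    simp only [expJ, flowV, Complex.real_smul, Fop, opJinv]
    push_cast
    ring
  rw [e1]
  generalize Gop p (expJ a b τ (flowV a b p ε (τ / 2) (ψ 0))) l = g2
  simp only [expJ]
  push_cast
  generalize Complex.exp (-(Complex.I * (τ : ℂ) * (zeta a b l : ℂ))) = θ' at *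
  generalize Complex.exp (Complex.I * (τ : ℂ) * (zeta a b l : ℂ)) = θ at *
  linear_combination (ψ τ l - (ε ^ p : ℂ) * Complex.I / (zeta a b l : ℂ) * (τ / 2) *
    (Gop p (ψ 0) l + τ * B l)) * hθ

/-- Local error of the alternative Strang splitting
`S̃_τ = φ_V^{τ/2} ∘ φ_T^τ ∘ φ_V^{τ/2}`:
`‖S̃_τ(ψ(t_n)) − S_{e,τ}(ψ(t_n))‖_s ≤ C ε^p τ³` for `0 < τ ≤ 1/ε^p`, with `C`
depending only on the `H^{s+1}`-bound `K` of the exact solution on `[0,T_ε]`. -/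
theorem strang2_local_error (a b : ℝ) (hab : a < b) (p : ℕ) (hp : 1 ≤ p)
    (s : ℝ) (hs : 1 ≤ s) (K : ℝ) (hK : 0 < K) :
    ∃ C > 0, ∀ (ε : ℝ), 0 < ε → ε ≤ 1 →
      ∀ (τ : ℝ), 0 < τ → τ ≤ 1 / ε ^ p →
      ∀ (Tε : ℝ) (Ψ : ℝ → ℤ → ℂ), IsExactSol a b p ε Ψ →
        (∀ t : ℝ, 0 ≤ t → t ≤ Tε →
          MemHs a b (s + 1) (Ψ t) ∧ sobNorm a b (s + 1) (Ψ t) ≤ K) →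
        ∀ n : ℕ, (n : ℝ) * τ + τ ≤ Tε →
          sobNorm a b s
              (fun l => strang2 a b p ε τ (Ψ ((n : ℝ) * τ)) l - Ψ ((n : ℝ) * τ + τ) l) ≤
            C * ε ^ p * τ ^ 3 := by
  obtain ⟨C, hC, H⟩ := core a b hab p s hs K hK
  refine ⟨C, hC, ?_⟩
  intro ε hε hε1 τ hτ hτε Tε Ψ hΨ hb n hn
  have hn0 : 0 ≤ (n : ℝ) * τ := by positivity
  have := (H ε hε hε1 τ hτ hτε (fun t => Ψ ((n : ℝ) * τ + t))
    (fun t l => (hΨ ((n : ℝ) * τ + t) l).comp_const_add ((n : ℝ) * τ) t)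
    (fun t h1 h2 => by
      obtain ⟨g1, g2⟩ := hb ((n : ℝ) * τ + t) (by linarith) (by linarith)
      exact HB.of_mem g1 g2)).sobNorm_le
  simpa only [add_zero] using this

end NKGE
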